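/- There exists κ' ∈ ℂ with κ'² = κ such that, setting ρ = (ασ − κ')/2, b = (α/ξ)·(κ'(1 − λ² + ασ − λσ − αλ²σ + λ³σ) + ζ + 2σλ(1−λ²) + σ²(2+α²+3αλ+(α²−4)λ²−3αλ³+2λ⁴) + ασ³(1+αλ−λ²)), s = (1/ξ)·(ακ'(−1−λσ) + α(−2−2λσ+2σ²+αλσ²−2λ²σ²+ασ³)), and r = −(1/(2ξ))·(κ'(−α²+2ασ−2αλ²σ+α²σ²) + 4ζ − α³σ + 2ασ²(α+2λ+αλ²−2λ³) + α³σ³), and assuming ρ ≠ 0 and r ≠ 0, the matrices P = [[−1,α],[0,−1]], Q = [[ρ,β],[σ,(1+βσ)/ρ]], M = [[λ,λ²−1],[1,λ]], N = [[r,b],[s,(1+bs)/r]] satisfy the genus-two surface group relation [P,Q][M,N] = I and the trace condition tr(P⁻¹N) = 2. -/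

import Mathlib

open Matrix Complex

theorem aux_field (α σ l k ξ ζ κ b s r : ℂ) (hk : k ^ 2 = κ)
    (hκ : κ = 4 - 4 * σ ^ 2 + α ^ 2 * σ ^ 2 - 4 * α * l * σ ^ 2 + 4 * l ^ 2 * σ ^ 2)
    (hξ : ξ = 4 + α ^ 2 - 4 * l ^ 2 + 4 * α * σ + 2 * α ^ 2 * l * σ
      - 4 * α * l ^ 2 * σ + α ^ 2 * σ ^ 2)
    (hζ : ζ = 2 - 2 * l ^ 2 + 2 * α * σ + α ^ 2 * l * σ - 2 * α * l ^ 2 * σ)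
    (hξ0 : ξ ≠ 0)
    (hb : ξ * b = α * (k * (1 - l ^ 2 + α * σ - l * σ - α * l ^ 2 * σ + l ^ 3 * σ)
          + ζ + 2 * σ * l * (1 - l ^ 2)
          + σ ^ 2 * (2 + α ^ 2 + 3 * α * l + (α ^ 2 - 4) * l ^ 2 - 3 * α * l ^ 3
            + 2 * l ^ 4)
          + α * σ ^ 3 * (1 + α * l - l ^ 2)))
    (hs : ξ * s = α * k * (-1 - l * σ)
          + α * (-2 - 2 * l * σ + 2 * σ ^ 2 + α * l * σ ^ 2 - 2 * l ^ 2 * σ ^ 2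
            + α * σ ^ 3))
    (hr : ξ * r = -(1 / 2) * (k * (-α ^ 2 + 2 * α * σ - 2 * α * l ^ 2 * σ + α ^ 2 * σ ^ 2)
          + 4 * ζ - α ^ 3 * σ + 2 * α * σ ^ 2 * (α + 2 * l + α * l ^ 2 - 2 * l ^ 3)
          + α ^ 3 * σ ^ 3)) :
    r * (-2 - r - α * s) - b * s = 1 ∧
    (1 + α ^ 2 * σ ^ 2 / 2 + α * σ * k / 2) * (l * r + (l ^ 2 - 1) * s)
      + α * ((κ - α ^ 2 * σ ^ 2) / 4 - 1) * (r + l * s) = r * l + b ∧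
    (1 + α ^ 2 * σ ^ 2 / 2 + α * σ * k / 2) * (l * b + (l ^ 2 - 1) * (-2 - r - α * s))
      + α * ((κ - α ^ 2 * σ ^ 2) / 4 - 1) * (b + l * (-2 - r - α * s))
      = r * (l ^ 2 - 1) + b * l ∧
    (-α * σ ^ 2) * (l * r + (l ^ 2 - 1) * s)
      + (1 + α ^ 2 * σ ^ 2 / 2 - α * σ * k / 2) * (r + l * s) = s * l + (-2 - r - α * s) ∧
    (-α * σ ^ 2) * (l * b + (l ^ 2 - 1) * (-2 - r - α * s))
      + (1 + α ^ 2 * σ ^ 2 / 2 - α * σ * k / 2) * (b + l * (-2 - r - α * s))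
      = s * (l ^ 2 - 1) + (-2 - r - α * s) * l := by
  obtain ⟨t, ht⟩ : ∃ t, t = -2 - r - α * s := ⟨_, rfl⟩
  obtain ⟨R1, hR1⟩ : ∃ x, x = -(1 / 2) * (-α ^ 2 + 2 * α * σ - 2 * α * l ^ 2 * σ
    + α ^ 2 * σ ^ 2) := ⟨_, rfl⟩
  obtain ⟨S1, hS1⟩ : ∃ x, x = α * (-1 - l * σ) := ⟨_, rfl⟩
  obtain ⟨B1, hB1⟩ : ∃ x, x = α * (1 - l ^ 2 + α * σ - l * σ - α * l ^ 2 * σ + l ^ 3 * σ) :=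
    ⟨_, rfl⟩
  obtain ⟨R, hR⟩ : ∃ x, x = ξ * r := ⟨_, rfl⟩
  obtain ⟨S, hS⟩ : ∃ x, x = ξ * s := ⟨_, rfl⟩
  obtain ⟨B, hB⟩ : ∃ x, x = ξ * b := ⟨_, rfl⟩
  obtain ⟨T, hT⟩ : ∃ x, x = ξ * t := ⟨_, rfl⟩
  have hT' : T = -2 * ξ - R - α * S := by rw [hT, hR, hS, ht]; ring
  obtain ⟨T1, hT1⟩ : ∃ x, x = -R1 - α * S1 := ⟨_, rfl⟩
  rw [← hR] at hr
  rw [← hS] at hs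
  rw [← hB] at hb
  rw [← ht]
  refine ⟨?_, ?_, ?_, ?_, ?_⟩
  · apply mul_left_cancel₀ (pow_ne_zero 2 hξ0)
    have h : R * T - B * S = ξ ^ 2 := by
      simp only [hT', hr, hs, hb, hζ, hξ]
      have hk2 := hk.trans hκ
      have hc := congrArg (fun z => (R1 * T1 - B1 * S1) * z) hk2
      simp only [hT1, hR1, hS1, hB1] at hc
      linear_combination hc
    simp only [hR, hT, hB, hS] at h
    linear_combination h
  · apply mul_left_cancel₀ hξ0
    have h : (1 + α ^ 2 * σ ^ 2 / 2 + α * σ * k / 2) * (l * R + (l ^ 2 - 1) * S) + (α * ((κ - α ^ 2 * σ ^ 2) / 4 - 1)) * (R + l * S)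
        = R * l + B := by
      simp only [hT', hr, hs, hb, hζ, hξ, hκ]
      have hk2 := hk.trans hκ
      have hc := congrArg (fun z => (α * σ / 2 * (l * R1 + (l ^ 2 - 1) * S1)) * z) hk2
      simp only [hT1, hR1, hS1, hB1] at hc
      linear_combination hc
    simp only [hR, hT, hB, hS] at h
    linear_combination h
  · apply mul_left_cancel₀ hξ0
    have h : (1 + α ^ 2 * σ ^ 2 / 2 + α * σ * k / 2) * (l * B + (l ^ 2 - 1) * T) + (α * ((κ - α ^ 2 * σ ^ 2) / 4 - 1)) * (B + l * T)
        = R * (l ^ 2 - 1) + B * l := by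
      simp only [hT', hr, hs, hb, hζ, hξ, hκ]
      have hk2 := hk.trans hκ
      have hc := congrArg (fun z => (α * σ / 2 * (l * B1 + (l ^ 2 - 1) * T1)) * z) hk2
      simp only [hT1, hR1, hS1, hB1] at hc
      linear_combination hc
    simp only [hR, hT, hB, hS] at h
    linear_combination h
  · apply mul_left_cancel₀ hξ0
    have h : (-α * σ ^ 2) * (l * R + (l ^ 2 - 1) * S) + (1 + α ^ 2 * σ ^ 2 / 2 - α * σ * k / 2) * (R + l * S)
        = S * l + T := by
      simp only [hT', hr, hs, hb, hζ, hξ, hκ]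
      have hk2 := hk.trans hκ
      have hc := congrArg (fun z => (-(α * σ / 2) * (R1 + l * S1)) * z) hk2
      simp only [hT1, hR1, hS1, hB1] at hc
      linear_combination hc
    simp only [hR, hT, hB, hS] at h
    linear_combination h
  · apply mul_left_cancel₀ hξ0
    have h : (-α * σ ^ 2) * (l * B + (l ^ 2 - 1) * T) + (1 + α ^ 2 * σ ^ 2 / 2 - α * σ * k / 2) * (B + l * T)
        = S * (l ^ 2 - 1) + T * l := by
      simp only [hT', hr, hs, hb, hζ, hξ, hκ]
      have hk2 := hk.trans hκ
      have hc := congrArg (fun z => (-(α * σ / 2) * (B1 + l * T1)) * z) hk2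
      simp only [hT1, hR1, hS1, hB1] at hc
      linear_combination hc
    simp only [hR, hT, hB, hS] at h
    linear_combination h

/-- There exists κ' ∈ ℂ with κ'² = κ such that, setting ρ, b, s, r by the
explicit formulae of the appendix and assuming ρ ≠ 0 and r ≠ 0, the matrices P, Q, M, N
satisfy the genus-two surface group relation [P,Q][M,N] = I and the trace condition
tr(P⁻¹N) = 2. -/
theorem stmt8 (α β σ lam : ℂ) (hα : α ≠ 0)
    (κ ξ ζ : ℂ)
    (hκ : κ = 4 - 4 * σ ^ 2 + α ^ 2 * σ ^ 2 - 4 * α * lam * σ ^ 2 + 4 * lam ^ 2 * σ ^ 2)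
    (hξ : ξ = 4 + α ^ 2 - 4 * lam ^ 2 + 4 * α * σ + 2 * α ^ 2 * lam * σ
      - 4 * α * lam ^ 2 * σ + α ^ 2 * σ ^ 2)
    (hζ : ζ = 2 - 2 * lam ^ 2 + 2 * α * σ + α ^ 2 * lam * σ - 2 * α * lam ^ 2 * σ)
    (hξ0 : ξ ≠ 0) :
    ∃ κ' : ℂ, κ' ^ 2 = κ ∧
      ∀ ρ b s r : ℂ,
        ρ = (α * σ - κ') / 2 →
        b = (α / ξ) * (κ' * (1 - lam ^ 2 + α * σ - lam * σ - α * lam ^ 2 * σ + lam ^ 3 * σ)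
          + ζ + 2 * σ * lam * (1 - lam ^ 2)
          + σ ^ 2 * (2 + α ^ 2 + 3 * α * lam + (α ^ 2 - 4) * lam ^ 2 - 3 * α * lam ^ 3
            + 2 * lam ^ 4)
          + α * σ ^ 3 * (1 + α * lam - lam ^ 2)) →
        s = (1 / ξ) * (α * κ' * (-1 - lam * σ)
          + α * (-2 - 2 * lam * σ + 2 * σ ^ 2 + α * lam * σ ^ 2 - 2 * lam ^ 2 * σ ^ 2
            + α * σ ^ 3)) →
        r = -(1 / (2 * ξ)) * (κ' * (-α ^ 2 + 2 * α * σ - 2 * α * lam ^ 2 * σ + α ^ 2 * σ ^ 2)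
          + 4 * ζ - α ^ 3 * σ + 2 * α * σ ^ 2 * (α + 2 * lam + α * lam ^ 2 - 2 * lam ^ 3)
          + α ^ 3 * σ ^ 3) →
        ρ ≠ 0 → r ≠ 0 →
        let P : Matrix (Fin 2) (Fin 2) ℂ := !![-1, α; 0, -1]
        let Q : Matrix (Fin 2) (Fin 2) ℂ := !![ρ, β; σ, (1 + β * σ) / ρ]
        let M : Matrix (Fin 2) (Fin 2) ℂ := !![lam, lam ^ 2 - 1; 1, lam]
        let N : Matrix (Fin 2) (Fin 2) ℂ := !![r, b; s, (1 + b * s) / r]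
        (P * Q * P⁻¹ * Q⁻¹) * (M * N * M⁻¹ * N⁻¹) = 1 ∧ (P⁻¹ * N).trace = 2 := by
  obtain ⟨k, hk⟩ := IsAlgClosed.exists_pow_nat_eq κ (n := 2) (by norm_num)
  refine ⟨k, hk, ?_⟩
  intro ρ b s r hρ hb hs hr hρ0 hr0 P Q M N
  obtain ⟨hdet, h11, h12, h21, h22⟩ := aux_field α σ lam k ξ ζ κ b s r hk hκ hξ hζ hξ0
    (by rw [hb]; field_simp) (by rw [hs]; field_simp) (by rw [hr]; field_simp)
  have ht : (1 + b * s) / r = -2 - r - α * s := by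
    rw [div_eq_iff hr0]; linear_combination -hdet
  obtain ⟨q, hq⟩ : ∃ q, q = (1 + β * σ) / ρ := ⟨_, rfl⟩
  have hq1 : ρ * q - β * σ = 1 := by rw [hq]; field_simp; ring
  have hP : P⁻¹ = !![-1, -α; 0, -1] := by
    apply Matrix.inv_eq_right_inv
    simp [P, Matrix.one_fin_two]
  have hQ : Q⁻¹ = !![q, -β; -σ, ρ] := by
    apply Matrix.inv_eq_right_inv
    simp only [Q, ← hq, Matrix.one_fin_two, Matrix.mul_fin_two]
    ext i j
    fin_cases i <;> fin_cases j <;> simp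
    · linear_combination hq1
    · ring
    · ring
    · linear_combination hq1
  have hMdet : IsUnit M.det := by
    have : M.det = 1 := by simp only [M, Matrix.det_fin_two_of]; ring
    rw [this]; exact isUnit_one
  have hNdet : IsUnit N.det := by
    have : N.det = 1 := by
      simp only [N, ht, Matrix.det_fin_two_of]; linear_combination hdet
    rw [this]; exact isUnit_one
  have hC : P * Q * P⁻¹ * Q⁻¹ = !![1 + α ^ 2 * σ ^ 2 / 2 + α * σ * k / 2,
      α * ((κ - α ^ 2 * σ ^ 2) / 4 - 1); -α * σ ^ 2,
      1 + α ^ 2 * σ ^ 2 / 2 - α * σ * k / 2] := by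
    rw [hP, hQ]
    simp only [P, Q, ← hq, Matrix.mul_fin_two]
    ext i j
    fin_cases i <;> fin_cases j <;> simp
    · linear_combination hq1 - α * σ * hρ
    · linear_combination -α * hq1 + α * (ρ + (α * σ - k) / 2 - α * σ) * hρ + α / 4 * hk
    · ring
    · linear_combination hq1 + α * σ * hρ
  have hCM : (P * Q * P⁻¹ * Q⁻¹) * M * N = N * M := by
    rw [hC]
    simp only [M, N, ht, Matrix.mul_fin_two]
    ext i j
    fin_cases i <;> fin_cases j <;> simp
    · linear_combination h11
    · linear_combination h12
    · linear_combination h21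
    · linear_combination h22
  constructor
  · calc (P * Q * P⁻¹ * Q⁻¹) * (M * N * M⁻¹ * N⁻¹)
        = ((P * Q * P⁻¹ * Q⁻¹) * M * N) * M⁻¹ * N⁻¹ := by simp only [Matrix.mul_assoc]
      _ = N * (M * M⁻¹) * N⁻¹ := by rw [hCM]; simp only [Matrix.mul_assoc]
      _ = 1 := by
        rw [Matrix.mul_nonsing_inv _ hMdet, Matrix.mul_one, Matrix.mul_nonsing_inv _ hNdet]
  · rw [hP]
    simp only [N, ht, Matrix.mul_fin_two, Matrix.trace_fin_two_of]
    ring
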